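/- Let Λ be a unique rectification poset, let λ, μ, ν be straight shapes in Λ, and let U be any unique rectification target of shape μ. Then c^ν_{λ,μ} is equal to the number of increasing tableaux of shape ν/λ that have U as a rectification. -/

import Mathlib

open Classical

noncomputable section

/-- A straight shape in a poset: a finite lower order ideal, given as a `Finset`. -/
def StraightShape {L : Type} [PartialOrder L] (lam : Finset L) : Prop :=
  ∀ a ∈ lam, ∀ b : L, b ≤ a → b ∈ lam

/-- The shape (set of boxes) of a partially defined tableau. -/
def shapeOf {L : Type} {V : Type} (T : L → Option V) : Set L := {α | T α ≠ none}

/-- `lam ⊆ nu` is a pair of straight shapes, defining the skew shape `nu / lam`. -/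
def IsSkewPair {L : Type} [PartialOrder L] (lam nu : Finset L) : Prop :=
  StraightShape lam ∧ StraightShape nu ∧ lam ⊆ nu

/-- `T` is defined on a skew shape `nu / lam`. -/
def HasSkewShape {L : Type} [PartialOrder L] (T : L → Option ℤ) : Prop :=
  ∃ lam nu : Finset L, IsSkewPair lam nu ∧ shapeOf T = (nu : Set L) \ (lam : Set L)

/-- `T` is strictly increasing along the partial order. -/
def Increasing {L : Type} [PartialOrder L] (T : L → Option ℤ) : Prop :=
  ∀ a b : L, a < b → ∀ x y : ℤ, T a = some x → T b = some y → x < y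

/-- An increasing tableau of skew shape. -/
def IncreasingSkewTableau {L : Type} [PartialOrder L] (T : L → Option ℤ) : Prop :=
  HasSkewShape T ∧ Increasing T

/-- Two boxes are neighbors if one covers the other. -/
def Neighbor {L : Type} [PartialOrder L] (a b : L) : Prop := a ⋖ b ∨ b ⋖ a

/-- The swap operation `swap_{s,s'}`. -/
def swapVal {L : Type} [PartialOrder L] {V : Type} (s s' : V) (T : L → Option V) :
    L → Option V := fun α =>
  if T α = some s ∧ ∃ β, Neighbor α β ∧ T β = some s' then some s'
  else if T α = some s' ∧ ∃ β, Neighbor α β ∧ T β = some s then some s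
  else T α

/-- Integer values extended with a dot `•`. -/
abbrev ZDot : Type := ℤ ⊕ Unit

def toDotted {L : Type} (T : L → Option ℤ) : L → Option ZDot := fun α => (T α).map Sum.inl

/-- Place a dot in every box of `C`. -/
def addDots {L : Type} (C : Finset L) (T : L → Option ZDot) : L → Option ZDot := fun α =>
  if α ∈ C then some (Sum.inr ()) else T α

/-- Restrict a dotted tableau to its integer-valued boxes. -/
def restrictInt {L : Type} (T : L → Option ZDot) : L → Option ℤ := fun α =>
  (T α).bind (Sum.elim some fun _ => none)

/-- Apply `swap_{a,•}, swap_{a+1,•}, …, swap_{a+n-1,•}` in this (increasing) order. -/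
def swapUp {L : Type} [PartialOrder L] (a : ℤ) : ℕ → (L → Option ZDot) → (L → Option ZDot)
  | 0, T => T
  | n + 1, T => swapVal (Sum.inl (a + n)) (Sum.inr ()) (swapUp a n T)

/-- Apply `swap_{b,•}, swap_{b-1,•}, …, swap_{b-n+1,•}` in this (decreasing) order. -/
def swapDown {L : Type} [PartialOrder L] (b : ℤ) : ℕ → (L → Option ZDot) → (L → Option ZDot)
  | 0, T => T
  | n + 1, T => swapVal (Sum.inl (b - n)) (Sum.inr ()) (swapDown b n T)

/-- All values of `T` lie in the interval `[a, b]`. -/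
def ValuesIn {L : Type} (T : L → Option ℤ) (a b : ℤ) : Prop :=
  ∀ (α : L) (x : ℤ), T α = some x → a ≤ x ∧ x ≤ b

/-- `T'` is obtained from `T` by a single forward jeu de taquin slide `jdt_C`,
starting from a set `C` of maximal boxes of the inner shape. -/
def IsForwardSlide {L : Type} [PartialOrder L] (T T' : L → Option ℤ) : Prop :=
  ∃ (lam nu C : Finset L) (a b : ℤ),
    IsSkewPair lam nu ∧ shapeOf T = (nu : Set L) \ (lam : Set L) ∧ ValuesIn T a b ∧
    (∀ c ∈ C, c ∈ lam ∧ ∀ d ∈ lam, ¬ c < d) ∧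
    T' = restrictInt (swapUp a (b - a + 1).toNat (addDots C (toDotted T)))

/-- `T'` is obtained from `T` by a single reverse jeu de taquin slide,
starting from a set `C` of minimal boxes of the complement of the outer shape. -/
def IsReverseSlide {L : Type} [PartialOrder L] (T T' : L → Option ℤ) : Prop :=
  ∃ (lam nu C : Finset L) (a b : ℤ),
    IsSkewPair lam nu ∧ shapeOf T = (nu : Set L) \ (lam : Set L) ∧ ValuesIn T a b ∧
    (∀ c ∈ C, c ∉ nu ∧ ∀ d : L, d ∉ nu → ¬ d < c) ∧
    T' = restrictInt (swapDown b (b - a + 1).toNat (addDots C (toDotted T)))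

/-- Jeu de taquin equivalence: a finite sequence of forward and reverse slides. -/
def JdtEquiv {L : Type} [PartialOrder L] (T T' : L → Option ℤ) : Prop :=
  Relation.ReflTransGen (fun A B => IsForwardSlide A B ∨ IsReverseSlide A B) T T'

/-- `T` is defined on a straight shape. -/
def HasStraightShape {L : Type} [PartialOrder L] (T : L → Option ℤ) : Prop :=
  ∃ lam : Finset L, StraightShape lam ∧ shapeOf T = (lam : Set L)

/-- `U` is a rectification of `T`: a straight-shape tableau obtained by forward slides. -/
def RectifiesTo {L : Type} [PartialOrder L] (T U : L → Option ℤ) : Prop :=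
  Relation.ReflTransGen IsForwardSlide T U ∧ HasStraightShape U

/-- Unique rectification target. -/
def IsURT {L : Type} [PartialOrder L] (U : L → Option ℤ) : Prop :=
  HasStraightShape U ∧ Increasing U ∧
    ∀ T : L → Option ℤ, IncreasingSkewTableau T → RectifiesTo T U →
      ∀ U' : L → Option ℤ, RectifiesTo T U' → U' = U

/-- The minimal increasing tableau of a shape `θ`: each box `α` receives the maximal
cardinality of a totally ordered subset of `θ` having `α` as its maximal element. -/
def minTab {L : Type} [PartialOrder L] (θ : Finset L) : L → Option ℤ := fun α =>
  if α ∈ θ then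
    some ((sSup {n : ℕ | ∃ s : Finset L, (s : Set L) ⊆ (θ : Set L) ∧
      (∀ a ∈ s, ∀ b ∈ s, a ≤ b ∨ b ≤ a) ∧ α ∈ s ∧ (∀ a ∈ s, a ≤ α) ∧ s.card = n} : ℕ) : ℤ)
  else none

/-- A unique rectification poset. -/
def IsURP (L : Type) [PartialOrder L] : Prop :=
  ∀ lam : Finset L, StraightShape lam → IsURT (minTab lam)

/-- The structure constant `c^ν_{λ,μ}`: the number of increasing tableaux of
shape `ν/λ` that have the minimal increasing tableau `M_μ` as a rectification. -/
def ccoef {L : Type} [PartialOrder L] (lam mu nu : Finset L) : ℕ :=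
  Set.ncard {T : L → Option ℤ | Increasing T ∧ shapeOf T = (nu : Set L) \ (lam : Set L) ∧
    RectifiesTo T (minTab mu)}

/-- Letters of a combined tableau: `inl` for the inner tableau, `inr` for the outer one. -/
abbrev Letter : Type := ℤ ⊕ ℤ

/-- The swap of the inner letter `p.1` with the outer letter `p.2`. -/
def swapStep {L : Type} [PartialOrder L] (p : ℤ × ℤ) (W : L → Option Letter) :
    L → Option Letter :=
  swapVal (Sum.inr p.2) (Sum.inl p.1) W

/-- Apply a list of swaps from left to right. -/
def runSwaps {L : Type} [PartialOrder L] (w : List (ℤ × ℤ)) (W : L → Option Letter) :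
    L → Option Letter :=
  w.foldl (fun W p => swapStep p W) W

/-- The outer part of a combined tableau. -/
def outerPart {L : Type} (W : L → Option Letter) : L → Option ℤ := fun α =>
  (W α).bind (Sum.elim (fun _ => none) some)

/-- The inner part of a combined tableau. -/
def innerPart {L : Type} (W : L → Option Letter) : L → Option ℤ := fun α =>
  (W α).bind (Sum.elim some (fun _ => none))

/-- The tableau with inner part `S` and outer part `T`. -/
def combineTab {L : Type} (S T : L → Option ℤ) : L → Option Letter := fun α =>
  (S α).elim ((T α).map Sum.inr) fun s => some (Sum.inl s)

/-- Exchange the roles of inner and outer letters. -/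
def flipTab {L : Type} (W : L → Option Letter) : L → Option Letter := fun α =>
  (W α).map Sum.swap

/-- View the inner letter `s` as a dot and forget the other inner letters. -/
def dotView {L : Type} (s : ℤ) (W : L → Option Letter) : L → Option ZDot := fun α =>
  (W α).bind (Sum.elim (fun s' => if s' = s then some (Sum.inr ()) else none)
    (fun t => some (Sum.inl t)))

/-- The order on letters in which the outer letter `t` precedes the inner letter `s` exactly
when `P s t` holds. -/
def letterLT (P : ℤ → ℤ → Prop) : Letter → Letter → Prop
  | Sum.inl s, Sum.inl s' => s < s'
  | Sum.inr t, Sum.inr t' => t < t'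
  | Sum.inl s, Sum.inr t => ¬ P s t
  | Sum.inr t, Sum.inl s => P s t

/-- The pairs swapped before `(s, t)` during an infusion. -/
def swappedBefore (s t : ℤ) : ℤ → ℤ → Prop := fun s' t' => s < s' ∨ (s' = s ∧ t' < t)

/-- All letters lie in `[a, a + n)`. -/
def LettersIn {L : Type} (a : ℤ) (n : ℕ) (W : L → Option Letter) : Prop :=
  ∀ α x, W α = some x → a ≤ Sum.elim id id x ∧ Sum.elim id id x < a + n

/-- A combined tableau of shape `nu` that is increasing for the letter order given by `P`. -/
structure GoodTab {L : Type} [PartialOrder L] (nu : Finset L) (a : ℤ) (n : ℕ)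
    (P : ℤ → ℤ → Prop) (W : L → Option Letter) : Prop where
  shape : ∀ α, α ∈ nu ↔ W α ≠ none
  letters : LettersIn a n W
  inc : ∀ α β, α < β → ∀ x y, W α = some x → W β = some y → letterLT P x y

section Parts

variable {L : Type}

lemma flipTab_eq_some (W : L → Option Letter) (α : L) (x : Letter) :
    flipTab W α = some x ↔ W α = some x.swap := by
  unfold flipTab
  rcases W α with _ | (y | y) <;> rcases x with x | x <;> simp

lemma restrictInt_dotView (s : ℤ) (W : L → Option Letter) :
    restrictInt (dotView s W) = outerPart W := by
  funext α
  unfold restrictInt dotView outerPart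
  rcases W α with _ | (y | y) <;> simp

lemma innerPart_eq_some (W : L → Option Letter) (α : L) (x : ℤ) :
    innerPart W α = some x ↔ W α = some (Sum.inl x) := by
  unfold innerPart
  rcases W α with _ | (y | y) <;> simp

lemma outerPart_eq_some (W : L → Option Letter) (α : L) (x : ℤ) :
    outerPart W α = some x ↔ W α = some (Sum.inr x) := by
  unfold outerPart
  rcases W α with _ | (y | y) <;> simp

lemma combineTab_outerPart_innerPart (W : L → Option Letter) :
    combineTab (outerPart W) (innerPart W) = flipTab W := by
  funext α
  unfold combineTab outerPart innerPart flipTab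
  rcases W α with _ | (y | y) <;> simp

lemma innerPart_combineTab (S T : L → Option ℤ) : innerPart (combineTab S T) = S := by
  funext α
  rcases hS : S α with _ | s <;> rcases hT : T α with _ | t <;>
    simp [combineTab, innerPart, hS, hT]

lemma outerPart_combineTab (S T : L → Option ℤ) (h : ∀ α, S α = none ∨ T α = none) :
    outerPart (combineTab S T) = T := by
  funext α
  have := h α
  rcases hS : S α with _ | s <;> rcases hT : T α with _ | t <;>
    simp_all [combineTab, outerPart]

lemma outerPart_flipTab (W : L → Option Letter) : outerPart (flipTab W) = innerPart W := by
  funext α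
  unfold innerPart outerPart flipTab
  rcases W α with _ | (y | y) <;> simp

lemma innerPart_flipTab (W : L → Option Letter) : innerPart (flipTab W) = outerPart W := by
  funext α
  unfold innerPart outerPart flipTab
  rcases W α with _ | (y | y) <;> simp

/-- All values lie in `[a, a + n)`. -/
def TabIn (a : ℤ) (n : ℕ) (T : L → Option ℤ) : Prop :=
  ∀ α x, T α = some x → a ≤ x ∧ x < a + n

lemma TabIn.mono {M M' : ℕ} {T : L → Option ℤ} (h : TabIn (-(M : ℤ)) (2 * M + 1) T)
    (hM : M ≤ M') : TabIn (-(M' : ℤ)) (2 * M' + 1) T := by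
  intro α x hx
  have := h α x hx
  push_cast at this ⊢
  omega

lemma exists_tabIn {T : L → Option ℤ} (h : (shapeOf T).Finite) :
    ∃ M : ℕ, TabIn (-(M : ℤ)) (2 * M + 1) T := by
  refine ⟨h.toFinset.sup fun α => ((T α).getD 0).natAbs, fun α x hx => ?_⟩
  have hα : α ∈ h.toFinset := by simp [shapeOf, hx]
  have := Finset.le_sup (f := fun α => ((T α).getD 0).natAbs) hα
  simp only [hx, Option.getD_some] at this
  push_cast
  omega

end Parts

section Swaps

variable {L : Type} [PartialOrder L]

lemma Neighbor.symm {α β : L} (h : Neighbor α β) : Neighbor β α := Or.symm h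

lemma swapVal_comm {V : Type} {s t : V} (hst : s ≠ t) (W : L → Option V) :
    swapVal s t W = swapVal t s W := by
  funext α
  unfold swapVal
  have : some s ≠ some t := by simpa using hst
  split_ifs <;> grind

lemma swapVal_exists_eq {V : Type} (s t : V) (W : L → Option V) (α : L) :
    ∃ β, swapVal s t W α = W β := by
  unfold swapVal
  split_ifs with h1 h2
  · obtain ⟨_, β, _, h⟩ := h1
    exact ⟨β, h.symm⟩
  · obtain ⟨_, β, _, h⟩ := h2
    exact ⟨β, h.symm⟩
  · exact ⟨α, rfl⟩

lemma swapVal_eq_none_iff {V : Type} (s t : V) (W : L → Option V) (α : L) :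
    swapVal s t W α = none ↔ W α = none := by
  unfold swapVal
  split_ifs <;> grind

lemma swapVal_eq_some_iff_of_ne {V : Type} {s t x : V} (hs : x ≠ s) (ht : x ≠ t)
    (W : L → Option V) (α : L) : swapVal s t W α = some x ↔ W α = some x := by
  unfold swapVal
  split_ifs <;> grind

lemma swapVal_swapVal {V : Type} {s t : V} (hst : s ≠ t) (W : L → Option V)
    (hanti : ∀ α β, Neighbor α β → ∀ x, W α = some x → W β ≠ some x) :
    swapVal s t (swapVal s t W) = W := by
  have key : ∀ α, swapVal s t W α = some s ↔ (W α = some s ∧ ¬ ∃ β, Neighbor α β ∧ W β = some t) ∨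
      (W α = some t ∧ ∃ β, Neighbor α β ∧ W β = some s) := by
    intro α; unfold swapVal; split_ifs <;> grind
  have key' : ∀ α, swapVal s t W α = some t ↔
      (W α = some t ∧ ¬ ∃ β, Neighbor α β ∧ W β = some s) ∨
      (W α = some s ∧ ∃ β, Neighbor α β ∧ W β = some t) := by
    intro α; unfold swapVal; split_ifs <;> grind
  have hs : ∀ α β, Neighbor α β → W α = some s → W β = some t →
      swapVal s t W α = some t ∧ swapVal s t W β = some s := fun α β h h1 h2 =>
    ⟨(key' α).2 (Or.inr ⟨h1, β, h, h2⟩), (key β).2 (Or.inr ⟨h2, α, h.symm, h1⟩)⟩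
  have hne : some s ≠ some t := by simpa using hst
  funext α
  rw [swapVal]
  by_cases h1 : W α = some s
  · by_cases h2 : ∃ β, Neighbor α β ∧ W β = some t
    · obtain ⟨β, hβ, hb⟩ := h2
      obtain ⟨e1, e2⟩ := hs α β hβ h1 hb
      rw [e1, if_neg (fun h => hne h.1.symm), if_pos ⟨rfl, β, hβ, e2⟩, h1]
    · have e1 : swapVal s t W α = some s := (key α).2 (Or.inl ⟨h1, h2⟩)
      rw [e1, if_neg, if_neg (fun h => hne h.1), h1]
      rintro ⟨-, β, hβ, hb⟩
      rcases (key' β).1 hb with ⟨hb, -⟩ | ⟨hb, -⟩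
      · exact h2 ⟨β, hβ, hb⟩
      · exact hanti α β hβ s h1 hb
  · by_cases h1' : W α = some t
    · by_cases h2 : ∃ β, Neighbor α β ∧ W β = some s
      · obtain ⟨β, hβ, hb⟩ := h2
        obtain ⟨e1, e2⟩ := hs β α hβ.symm hb h1'
        rw [e2, if_pos ⟨rfl, β, hβ, e1⟩, h1']
      · have e1 : swapVal s t W α = some t := (key' α).2 (Or.inl ⟨h1', h2⟩)
        rw [e1, if_neg (fun h => hne h.1.symm), if_neg, h1']
        rintro ⟨-, β, hβ, hb⟩
        rcases (key β).1 hb with ⟨hb, -⟩ | ⟨hb, -⟩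
        · exact h2 ⟨β, hβ, hb⟩
        · exact hanti α β hβ t h1' hb
    · have e1 : swapVal s t W α = W α := by
        unfold swapVal
        simp [h1, h1']
      rw [e1]
      simp [h1, h1']

lemma swapVal_swapVal_comm {V : Type} {s t s' t' : V} (h1 : s ≠ s') (h2 : s ≠ t') (h3 : t ≠ s')
    (h4 : t ≠ t') (W : L → Option V) :
    swapVal s t (swapVal s' t' W) = swapVal s' t' (swapVal s t W) := by
  funext α
  have e : ∀ (x y : V) (W : L → Option V), swapVal x y W α =
      if W α = some x ∧ ∃ β, Neighbor α β ∧ W β = some y then some y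
      else if W α = some y ∧ ∃ β, Neighbor α β ∧ W β = some x then some x else W α :=
    fun _ _ _ => rfl
  rw [e s t (swapVal s' t' W), e s' t' (swapVal s t W)]
  simp only [swapVal_eq_some_iff_of_ne h1 h2, swapVal_eq_some_iff_of_ne h3 h4,
    swapVal_eq_some_iff_of_ne h1.symm h3.symm, swapVal_eq_some_iff_of_ne h2.symm h4.symm]
  rw [e s t, e s' t']
  split_ifs <;> grind

lemma swapStep_comm {p q : ℤ × ℤ} (h1 : p.1 ≠ q.1) (h2 : p.2 ≠ q.2) (W : L → Option Letter) :
    swapStep p (swapStep q W) = swapStep q (swapStep p W) :=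
  swapVal_swapVal_comm (by simpa using h2) (by simp) (by simp) (by simpa using h1) W

lemma runSwaps_append (w w' : List (ℤ × ℤ)) (W : L → Option Letter) :
    runSwaps (w ++ w') W = runSwaps w' (runSwaps w W) := by
  simp [runSwaps]

lemma runSwaps_cons (p : ℤ × ℤ) (w : List (ℤ × ℤ)) (W : L → Option Letter) :
    runSwaps (p :: w) W = runSwaps w (swapStep p W) := rfl

lemma runSwaps_nil (W : L → Option Letter) : runSwaps [] W = W := rfl

lemma runSwaps_exists_eq (w : List (ℤ × ℤ)) (W : L → Option Letter) (α : L) :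
    ∃ β, runSwaps w W α = W β := by
  induction w generalizing W with
  | nil => exact ⟨α, rfl⟩
  | cons p w ih =>
    obtain ⟨β, hβ⟩ := ih (swapStep p W)
    obtain ⟨γ, hγ⟩ := swapVal_exists_eq (Sum.inr p.2) (Sum.inl p.1) W β
    exact ⟨γ, hβ.trans hγ⟩

lemma swapStep_runSwaps_comm (p : ℤ × ℤ) (w : List (ℤ × ℤ))
    (h : ∀ q ∈ w, p.1 ≠ q.1 ∧ p.2 ≠ q.2) (W : L → Option Letter) :
    runSwaps w (swapStep p W) = swapStep p (runSwaps w W) := by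
  induction w generalizing W with
  | nil => rfl
  | cons q w ih =>
    rw [runSwaps_cons, runSwaps_cons,
      swapStep_comm (h q (by simp)).1.symm (h q (by simp)).2.symm,
      ih (fun r hr => h r (by simp [hr]))]

lemma runSwaps_comm (w w' : List (ℤ × ℤ))
    (h : ∀ p ∈ w, ∀ q ∈ w', p.1 ≠ q.1 ∧ p.2 ≠ q.2) (W : L → Option Letter) :
    runSwaps w' (runSwaps w W) = runSwaps w (runSwaps w' W) := by
  induction w generalizing W with
  | nil => rfl
  | cons p w ih =>
    rw [runSwaps_cons, runSwaps_cons, ih (fun r hr => h r (by simp [hr])),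
      swapStep_runSwaps_comm p w' (h p (by simp))]

/-- All pairs in lexicographic order of positions. -/
def pairWord (A B : List ℤ) : List (ℤ × ℤ) := A.flatMap fun s => B.map fun t => (s, t)

lemma pairWord_reverse (A B : List ℤ) :
    (pairWord A B).reverse = pairWord A.reverse B.reverse := by
  unfold pairWord
  rw [List.reverse_flatMap]
  congr 1
  funext s
  simp

lemma runSwaps_pairWord_cons_right (A B : List ℤ) (t : ℤ) (hA : A.Nodup) (ht : t ∉ B)
    (W : L → Option Letter) :
    runSwaps (pairWord A (t :: B)) W =
      runSwaps (pairWord A B) (runSwaps (A.map fun s => (s, t)) W) := by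
  induction A generalizing W with
  | nil => rfl
  | cons s A ih =>
    rw [List.nodup_cons] at hA
    have e1 : ∀ B', pairWord (s :: A) B' = (B'.map fun t => (s, t)) ++ pairWord A B' := by
      intro B'; simp [pairWord]
    rw [e1, e1, runSwaps_append, runSwaps_append, ih hA.2, List.map_cons, List.map_cons,
      runSwaps_cons, runSwaps_cons]
    congr 1
    refine runSwaps_comm _ _ ?_ _
    intro p hp q hq
    simp only [List.mem_map] at hp hq
    obtain ⟨t', ht', rfl⟩ := hp
    obtain ⟨s', hs', rfl⟩ := hq
    exact ⟨fun h => hA.1 ((show s = s' from h) ▸ hs'), fun h => ht ((show t' = t from h) ▸ ht')⟩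

lemma runSwaps_pairWord_swap (A B : List ℤ) (hA : A.Nodup) (hB : B.Nodup)
    (W : L → Option Letter) :
    runSwaps (pairWord A B) W = runSwaps ((pairWord B A).map Prod.swap) W := by
  induction B generalizing W with
  | nil =>
    have e1 : pairWord A [] = [] := List.flatMap_eq_nil_iff.2 fun _ _ => rfl
    rw [e1]
    rfl
  | cons t B ih =>
    rw [List.nodup_cons] at hB
    have e1 : pairWord (t :: B) A = (A.map fun s => (t, s)) ++ pairWord B A := by
      simp [pairWord]
    rw [runSwaps_pairWord_cons_right A B t hA hB.1, ih hB.2, e1, List.map_append,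
      runSwaps_append, List.map_map]
    rfl

lemma swapStep_flipTab (p : ℤ × ℤ) (W : L → Option Letter) :
    swapStep p (flipTab W) = flipTab (swapStep p.swap W) := by
  funext α
  unfold swapStep
  rw [swapVal_comm (by simp)]
  change swapVal _ _ _ α = (swapVal _ _ W α).map Sum.swap
  conv_lhs => rw [swapVal]
  simp only [flipTab_eq_some, Sum.swap_inl, Sum.swap_inr]
  rw [swapVal]
  simp only [Prod.fst_swap, Prod.snd_swap]
  split_ifs <;> simp [flipTab]

lemma runSwaps_flipTab (w : List (ℤ × ℤ)) (W : L → Option Letter) :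
    runSwaps w (flipTab W) = flipTab (runSwaps (w.map Prod.swap) W) := by
  induction w generalizing W with
  | nil => rfl
  | cons p w ih => rw [runSwaps_cons, swapStep_flipTab, ih, List.map_cons, runSwaps_cons]

/-- The letters `a, …, a + n - 1` in increasing order. -/
def lettersUp (a : ℤ) (n : ℕ) : List ℤ := (List.range n).map fun i : ℕ => a + (i : ℤ)

lemma lettersUp_succ (a : ℤ) (n : ℕ) : lettersUp a (n + 1) = lettersUp a n ++ [a + n] := by
  simp [lettersUp, List.range_succ]

lemma lettersUp_nodup (a : ℤ) (n : ℕ) : (lettersUp a n).Nodup :=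
  List.Nodup.map (fun i j h => by simpa using h) List.nodup_range

/-- The word of swaps performing an infusion. -/
def infusionWord (a : ℤ) (m n : ℕ) : List (ℤ × ℤ) :=
  pairWord (lettersUp a m).reverse (lettersUp a n)

lemma infusionWord_succ (a : ℤ) (m n : ℕ) : infusionWord a (m + 1) n =
    ((lettersUp a n).map fun t => (a + (m : ℤ), t)) ++ infusionWord a m n := by
  simp [infusionWord, lettersUp_succ, pairWord]

lemma runSwaps_infusionWord_flipTab (a : ℤ) (n : ℕ) (W : L → Option Letter) :
    runSwaps (infusionWord a n n) (flipTab W) =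
      flipTab (runSwaps (infusionWord a n n).reverse W) := by
  rw [runSwaps_flipTab]
  congr 1
  unfold infusionWord
  rw [pairWord_reverse, List.reverse_reverse,
    runSwaps_pairWord_swap _ _ (lettersUp_nodup a n) (List.nodup_reverse.2 (lettersUp_nodup a n))]

lemma swapUp_dotView (a s : ℤ) (n : ℕ) (W : L → Option Letter) :
    swapUp a n (dotView s W) = dotView s (runSwaps ((lettersUp a n).map fun t => (s, t)) W) := by
  induction n with
  | zero => rfl
  | succ n ih =>
    rw [swapUp, ih, lettersUp_succ, List.map_append, runSwaps_append]
    generalize runSwaps ((lettersUp a n).map fun t => (s, t)) W = W'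
    have hl : ∀ α, dotView s W' α = some (Sum.inl (a + n)) ↔ W' α = some (Sum.inr (a + n)) := by
      intro α; unfold dotView; rcases W' α with _ | (y | y) <;> simp
    have hr : ∀ α, dotView s W' α = some (Sum.inr ()) ↔ W' α = some (Sum.inl s) := by
      intro α; unfold dotView; rcases W' α with _ | (y | y) <;> simp
    funext α
    rw [swapVal]
    simp only [hl, hr, List.map_cons, List.map_nil, runSwaps_cons, runSwaps_nil]
    unfold swapStep swapVal dotView
    simp only
    split_ifs <;> simp

end Swaps

section Good

variable {L : Type} [PartialOrder L] {nu : Finset L} {a : ℤ} {n : ℕ}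

lemma GoodTab.congr {P P' : ℤ → ℤ → Prop} {W : L → Option Letter} (h : GoodTab nu a n P W)
    (hP : ∀ s t, a ≤ s → s < a + n → a ≤ t → t < a + n → (P s t ↔ P' s t)) :
    GoodTab nu a n P' W := by
  refine ⟨h.shape, h.letters, fun α β hab x y hx hy => ?_⟩
  have h1 := h.inc α β hab x y hx hy
  have h2 := h.letters α x hx
  have h3 := h.letters β y hy
  rcases x with x | x <;> rcases y with y | y <;> simp only [letterLT, Sum.elim_inl, Sum.elim_inr,
    id] at h1 h2 h3 ⊢
  · exact h1
  · rwa [← hP x y h2.1 h2.2 h3.1 h3.2]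
  · rwa [← hP y x h3.1 h3.2 h2.1 h2.2]
  · exact h1

lemma GoodTab.anti {P : ℤ → ℤ → Prop} {W : L → Option Letter} (h : GoodTab nu a n P W)
    (α β : L) (hab : Neighbor α β) (x : Letter) (hx : W α = some x) : W β ≠ some x := by
  intro hy
  have : letterLT P x x := by
    rcases hab with hab | hab
    · exact h.inc α β hab.lt x x hx hy
    · exact h.inc β α hab.lt x x hy hx
  rcases x with x | x <;> simp [letterLT] at this

lemma GoodTab.swapStep_swapStep {P : ℤ → ℤ → Prop} {W : L → Option Letter}
    (h : GoodTab nu a n P W) (p : ℤ × ℤ) : swapStep p (swapStep p W) = W :=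
  swapVal_swapVal (by simp) W h.anti

lemma GoodTab.swapStep {s t : ℤ} {W : L → Option Letter} (hnu : StraightShape nu)
    (h : GoodTab nu a n (swappedBefore s t) W) :
    GoodTab nu a n (swappedBefore s (t + 1)) (swapStep (s, t) W) := by
  refine ⟨fun α => ?_, fun α x hx => ?_, fun α β hab x y hx hy => ?_⟩
  · rw [h.shape, Ne, Ne, _root_.swapStep, swapVal_eq_none_iff]
  · obtain ⟨β, hβ⟩ := swapVal_exists_eq (Sum.inr t) (Sum.inl s) W α
    exact h.letters β x (hβ ▸ hx)
  · have hx0 : W α ≠ none := by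
      rw [Ne, ← swapVal_eq_none_iff (Sum.inr t) (Sum.inl s)]
      exact fun h => by simp [_root_.swapStep, h] at hx
    have hy0 : W β ≠ none := by
      rw [Ne, ← swapVal_eq_none_iff (Sum.inr t) (Sum.inl s)]
      exact fun h => by simp [_root_.swapStep, h] at hy
    obtain ⟨x0, hx0⟩ := Option.ne_none_iff_exists'.1 hx0
    obtain ⟨y0, hy0⟩ := Option.ne_none_iff_exists'.1 hy0
    have hlt := h.inc α β hab x0 y0 hx0 hy0
    have hval : ∀ γ z z0, W γ = some z0 → _root_.swapStep (s, t) W γ = some z →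
        z = z0 ∨ (z0 = Sum.inl s ∧ z = Sum.inr t) ∨ (z0 = Sum.inr t ∧ z = Sum.inl s) := by
      intro γ z z0 h0 h1
      unfold _root_.swapStep swapVal at h1
      split_ifs at h1 <;> grind
    by_cases hst : x0 = Sum.inl s ∧ y0 = Sum.inr t
    · obtain ⟨rfl, rfl⟩ := hst
      have hcov : α ⋖ β := by
        refine ⟨hab, fun γ h1 h2 => ?_⟩
        have hγ : W γ ≠ none :=
          (h.shape γ).1 (hnu β ((h.shape β).2 (by simp [hy0])) γ h2.le)
        obtain ⟨z, hz⟩ := Option.ne_none_iff_exists'.1 hγ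
        have i1 := h.inc α γ h1 _ _ hx0 hz
        have i2 := h.inc γ β h2 _ _ hz hy0
        rcases z with z | z <;> simp only [letterLT, swappedBefore, lt_irrefl, false_or, true_and] at i1 i2 <;> omega
      have e1 : _root_.swapStep (s, t) W α = some (Sum.inr t) := by
        unfold _root_.swapStep swapVal
        rw [if_neg (by simp [hx0]), if_pos ⟨hx0, β, Or.inl hcov, hy0⟩]
      have e2 : _root_.swapStep (s, t) W β = some (Sum.inl s) := by
        unfold _root_.swapStep swapVal
        rw [if_pos ⟨hy0, α, Or.inr hcov, hx0⟩]
      rw [e1, Option.some_inj] at hx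
      rw [e2, Option.some_inj] at hy
      subst hx hy
      simp [letterLT, swappedBefore]
    · have vx := hval α x x0 hx0 hx
      have vy := hval β y y0 hy0 hy
      have hst' : ¬ (x0 = Sum.inr t ∧ y0 = Sum.inl s) := by
        rintro ⟨rfl, rfl⟩
        simp [letterLT, swappedBefore] at hlt
      rcases vx with rfl | ⟨rfl, rfl⟩ | ⟨rfl, rfl⟩ <;>
      rcases vy with rfl | ⟨rfl, rfl⟩ | ⟨rfl, rfl⟩ <;>
      (try rcases x with x | x) <;> (try rcases y with y | y) <;>
      simp only [letterLT, swappedBefore, Sum.inl.injEq, Sum.inr.injEq, reduceCtorEq, and_false,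
        false_and, and_true, true_and, not_false_eq_true, not_true_eq_false] at hlt hst hst' ⊢ <;>
      omega

lemma GoodTab.row {s : ℤ} {W : L → Option Letter} (hnu : StraightShape nu) (k : ℕ)
    (h : GoodTab nu a n (swappedBefore s a) W) :
    GoodTab nu a n (swappedBefore s (a + k))
      (runSwaps ((lettersUp a k).map fun t => (s, t)) W) ∧
    runSwaps ((lettersUp a k).map fun t => (s, t)).reverse
      (runSwaps ((lettersUp a k).map fun t => (s, t)) W) = W := by
  induction k with
  | zero => simpa [lettersUp, runSwaps] using h
  | succ k ih =>
    rw [lettersUp_succ, List.map_append, List.reverse_append, runSwaps_append, runSwaps_append]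
    simp only [List.map_cons, List.map_nil, List.reverse_singleton, runSwaps_cons, runSwaps_nil]
    rw [ih.1.swapStep_swapStep]
    refine ⟨?_, ih.2⟩
    have := ih.1.swapStep hnu
    simpa [add_assoc] using this

lemma GoodTab.isForwardSlide {s : ℤ} {W : L → Option Letter} (hnu : StraightShape nu)
    (h : GoodTab nu a n (swappedBefore s a) W) :
    IsForwardSlide (outerPart W)
      (outerPart (runSwaps ((lettersUp a n).map fun t => (s, t)) W)) := by
  have hin : ∀ {α x}, W α = some x → α ∈ nu := fun hx => (h.shape _).2 (by simp [hx])
  have hdown : ∀ {α β : L} {x : Letter}, W α = some x → β ≤ α →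
      ∃ y, W β = some y ∧ (y = x ∨ letterLT (swappedBefore s a) y x) := by
    intro α β x hx hle
    obtain ⟨y, hy⟩ := Option.ne_none_iff_exists'.1 ((h.shape β).1 (hnu α (hin hx) β hle))
    refine ⟨y, hy, ?_⟩
    rcases hle.eq_or_lt with rfl | hlt
    · left; simpa [hx] using hy.symm
    · exact Or.inr (h.inc _ _ hlt _ _ hy hx)
  refine ⟨nu.filter fun α => ∃ s' ≤ s, W α = some (Sum.inl s'),
    nu.filter fun α => ∀ s', W α = some (Sum.inl s') → s' ≤ s,
    nu.filter fun α => W α = some (Sum.inl s), a, a + n - 1, ⟨?_, ?_, ?_⟩, ?_, ?_, ?_, ?_⟩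
  · intro α hα β hle
    simp only [Finset.mem_filter] at hα ⊢
    obtain ⟨-, s', hs', hα⟩ := hα
    obtain ⟨y, hy, hyx⟩ := hdown hα hle
    refine ⟨hin hy, ?_⟩
    have hr := h.letters β y hy
    rcases hyx with rfl | hlt
    · exact ⟨s', hs', hy⟩
    · rcases y with y | y
      · simp only [letterLT] at hlt
        exact ⟨y, by omega, hy⟩
      · simp only [letterLT, swappedBefore, Sum.elim_inr, id] at hlt hr
        omega
  · intro α hα β hle
    simp only [Finset.mem_filter] at hα ⊢
    obtain ⟨x, hx⟩ := Option.ne_none_iff_exists'.1 ((h.shape α).1 hα.1)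
    obtain ⟨y, hy, hyx⟩ := hdown hx hle
    refine ⟨hin hy, fun s' hs' => ?_⟩
    have hxx := hα.2
    rw [hy, Option.some_inj] at hs'
    subst hs'
    rcases hyx with rfl | hlt
    · exact hxx _ hx
    · rcases x with x | x
      · have := hxx x hx
        simp only [letterLT] at hlt
        omega
      · simp only [letterLT, swappedBefore] at hlt
        omega
  · intro α hα
    simp only [Finset.mem_filter] at hα ⊢
    obtain ⟨h0, s', hs', hα⟩ := hα
    exact ⟨h0, fun s'' h'' => by rw [hα] at h''; simp at h''; omega⟩
  · ext α
    have := h.shape α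
    simp only [shapeOf, outerPart, Set.mem_ofPred_eq, Set.mem_sdiff, Finset.mem_coe,
      Finset.mem_filter, this]
    rcases W α with _ | (y | y) <;> simp
  · intro α x hx
    have : W α = some (Sum.inr x) := by
      unfold outerPart at hx
      rcases hW : W α with _ | (y | y) <;> simp_all
    have := h.letters α _ this
    simp only [Sum.elim_inr, id] at this
    omega
  · intro α hα
    simp only [Finset.mem_filter] at hα ⊢
    refine ⟨⟨hα.1, s, le_rfl, hα.2⟩, ?_⟩
    rintro β ⟨-, s', hs', hβ⟩ hlt
    have := h.inc _ _ hlt _ _ hα.2 hβ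
    simp only [letterLT] at this
    omega
  · have e : (a + (n : ℤ) - 1 - a + 1).toNat = n := by omega
    rw [e, ← restrictInt_dotView s, ← swapUp_dotView]
    congr 2
    funext α
    have := h.shape α
    simp only [dotView, addDots, toDotted, outerPart, Finset.mem_filter, this]
    rcases W α with _ | (y | y) <;> simp

lemma GoodTab.infusion {W : L → Option Letter} (hnu : StraightShape nu) (m : ℕ)
    (h : GoodTab nu a n (swappedBefore (a + m - 1) a) W) :
    GoodTab nu a n (swappedBefore (a - 1) a) (runSwaps (infusionWord a m n) W) ∧
    runSwaps (infusionWord a m n).reverse (runSwaps (infusionWord a m n) W) = W ∧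
    Relation.ReflTransGen IsForwardSlide (outerPart W)
      (outerPart (runSwaps (infusionWord a m n) W)) := by
  induction m generalizing W with
  | zero =>
    refine ⟨by simpa [infusionWord, lettersUp, pairWord, runSwaps] using h,
      by simp [infusionWord, lettersUp, pairWord, runSwaps], ?_⟩
    exact Relation.ReflTransGen.refl
  | succ m ih =>
    have h' : GoodTab nu a n (swappedBefore (a + m) a) W := by
      convert h using 2
      push_cast; ring
    have hr := h'.row hnu n
    have ihr := ih (hr.1.congr (P' := swappedBefore (a + m - 1) a)
      (fun s t _ _ _ _ => by unfold swappedBefore; omega))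
    rw [infusionWord_succ, List.reverse_append, runSwaps_append, runSwaps_append, ihr.2.1]
    exact ⟨ihr.1, hr.2, Relation.ReflTransGen.head (h'.isForwardSlide hnu) ihr.2.2⟩

end Good

section Infusion

variable {L : Type} [PartialOrder L]

/-- The combined tableau after infusing `T` through `S`. -/
def infuse (a : ℤ) (n : ℕ) (S T : L → Option ℤ) : L → Option Letter :=
  runSwaps (infusionWord a n n) (combineTab S T)

theorem infuse_spec {lam nu : Finset L} (hl : StraightShape lam) (hnu : StraightShape nu)
    (hln : lam ⊆ nu) {a : ℤ} {n : ℕ} {S T : L → Option ℤ}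
    (hS : Increasing S) (hSsh : shapeOf S = (lam : Set L)) (hSin : TabIn a n S)
    (hT : Increasing T) (hTsh : shapeOf T = (nu : Set L) \ (lam : Set L)) (hTin : TabIn a n T) :
    (∃ mu : Finset L, StraightShape mu ∧ mu ⊆ nu ∧
      shapeOf (outerPart (infuse a n S T)) = (mu : Set L) ∧
      shapeOf (innerPart (infuse a n S T)) = (nu : Set L) \ (mu : Set L)) ∧
    Increasing (innerPart (infuse a n S T)) ∧
    TabIn a n (innerPart (infuse a n S T)) ∧
    Relation.ReflTransGen IsForwardSlide T (outerPart (infuse a n S T)) ∧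
    infuse a n (outerPart (infuse a n S T)) (innerPart (infuse a n S T)) =
      flipTab (combineTab S T) ∧
    (∀ α x, T α = some x → ∃ β, outerPart (infuse a n S T) β = some x) := by
  have hS' : ∀ α, α ∈ lam ↔ S α ≠ none := fun α => by
    rw [← Finset.mem_coe, ← hSsh]; rfl
  have hT' : ∀ α, (α ∈ nu ∧ α ∉ lam) ↔ T α ≠ none := fun α => by
    have : α ∈ (nu : Set L) \ (lam : Set L) ↔ T α ≠ none := by rw [← hTsh]; rfl
    simpa using this
  have hdisj : ∀ α, S α = none ∨ T α = none := fun α => by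
    have := hS' α; have := hT' α; tauto
  have hin : ∀ α s, combineTab S T α = some (Sum.inl s) ↔ S α = some s := fun α s => by
    rw [← innerPart_eq_some, innerPart_combineTab]
  have hout : ∀ α t, combineTab S T α = some (Sum.inr t) ↔ T α = some t := fun α t => by
    rw [← outerPart_eq_some, outerPart_combineTab S T hdisj]
  have hgood : GoodTab nu a n (swappedBefore (a + n - 1) a) (combineTab S T) := by
    refine ⟨fun α => ?_, fun α x hx => ?_, fun α β hab x y hx hy => ?_⟩
    · have h1 := hS' α
      have h2 := hT' α
      have h3 := @hln α
      unfold combineTab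
      rcases hSα : S α with _ | s
      · rcases hTα : T α with _ | t <;> simp_all
      · simp_all
    · rcases x with x | x
      · exact hSin α x ((hin _ _).1 hx)
      · exact hTin α x ((hout _ _).1 hx)
    · rcases x with x | x <;> rcases y with y | y <;> simp only [hin, hout] at hx hy
      · exact hS α β hab x y hx hy
      · have h1 := hSin α x hx
        have h2 := hTin β y hy
        simp only [letterLT, swappedBefore]
        omega
      · have hβ : β ∈ lam := (hS' β).2 (by simp [hy])
        have hα := hl β hβ α hab.le
        exact absurd hα ((hT' α).2 (by simp [hx])).2
      · exact hT α β hab x y hx hy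
  obtain ⟨hG, hrev, hslide⟩ := hgood.infusion hnu n
  rw [outerPart_combineTab S T hdisj] at hslide
  change GoodTab nu a n _ (infuse a n S T) at hG
  change runSwaps _ (infuse a n S T) = _ at hrev
  change Relation.ReflTransGen _ _ (outerPart (infuse a n S T)) at hslide
  have hlow : ∀ α t β, infuse a n S T α = some (Sum.inr t) → β ≤ α →
      ∃ t', infuse a n S T β = some (Sum.inr t') := by
    intro α t β hα hle
    obtain ⟨y, hy⟩ := Option.ne_none_iff_exists'.1
      ((hG.shape β).1 (hnu α ((hG.shape α).2 (by simp [hα])) β hle))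
    rcases hle.eq_or_lt with rfl | hlt
    · exact ⟨t, hα⟩
    · rcases y with y | y
      · have h1 := hG.inc _ _ hlt _ _ hy hα
        have h2 := hG.letters _ _ hy
        simp only [letterLT, swappedBefore, Sum.elim_inl, id] at h1 h2
        omega
      · exact ⟨y, hy⟩
  refine ⟨⟨nu.filter fun α => ∃ t, infuse a n S T α = some (Sum.inr t), ?_,
    Finset.filter_subset _ _, ?_, ?_⟩, ?_, ?_, hslide, ?_, ?_⟩
  · intro α hα β hle
    simp only [Finset.mem_filter] at hα ⊢
    obtain ⟨h0, t, ht⟩ := hα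
    exact ⟨hnu α h0 β hle, hlow α t β ht hle⟩
  · ext α
    have := hG.shape α
    simp only [shapeOf, outerPart, Set.mem_ofPred_eq, Finset.mem_coe, Finset.mem_filter, this]
    rcases infuse a n S T α with _ | (y | y) <;> simp
  · ext α
    have := hG.shape α
    simp only [shapeOf, innerPart, Set.mem_ofPred_eq, Set.mem_sdiff, Finset.mem_coe,
      Finset.mem_filter, this]
    rcases infuse a n S T α with _ | (y | y) <;> simp
  · intro α β hab x y hx hy
    rw [innerPart_eq_some] at hx hy
    exact hG.inc α β hab _ _ hx hy
  · intro α x hx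
    rw [innerPart_eq_some] at hx
    exact hG.letters α _ hx
  · rw [infuse, combineTab_outerPart_innerPart, runSwaps_infusionWord_flipTab, hrev]
  · intro α x hx
    rw [← hout, ← hrev] at hx
    obtain ⟨β, hβ⟩ := runSwaps_exists_eq (infusionWord a n n).reverse (infuse a n S T) α
    exact ⟨β, by rw [outerPart_eq_some, ← hβ, hx]⟩

/-- The increasing tableaux of shape `nu / lam` having `U` as a rectification. -/
def rectFiber (nu lam : Finset L) (U : L → Option ℤ) : Set (L → Option ℤ) :=
  {T | Increasing T ∧ shapeOf T = (nu : Set L) \ (lam : Set L) ∧ RectifiesTo T U}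

lemma outerPart_infuse_of_mem_rectFiber {lam nu : Finset L} (hl : StraightShape lam)
    (hnu : StraightShape nu) (hln : lam ⊆ nu) {a : ℤ} {n : ℕ} {S T U : L → Option ℤ}
    (hS : Increasing S) (hSsh : shapeOf S = (lam : Set L)) (hSin : TabIn a n S)
    (hU : IsURT U) (hT : T ∈ rectFiber nu lam U) (hTin : TabIn a n T) :
    outerPart (infuse a n S T) = U := by
  obtain ⟨⟨mu, h1, -, h2, -⟩, -, -, h3, -, -⟩ :=
    infuse_spec hl hnu hln hS hSsh hSin hT.1 hT.2.1 hTin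
  exact hU.2.2 T ⟨⟨lam, nu, ⟨hl, hnu, hln⟩, hT.2.1⟩, hT.1⟩ hT.2.2 _ ⟨h3, mu, h1, h2⟩

lemma finite_shapeOf_of_mem_rectFiber {lam nu : Finset L} {T U : L → Option ℤ}
    (hT : T ∈ rectFiber nu lam U) : (shapeOf T).Finite := by
  rw [hT.2.1]
  exact nu.finite_toSet.subset Set.sdiff_subset

lemma tabIn_of_mem_rectFiber {lam nu : Finset L} (hl : StraightShape lam)
    (hnu : StraightShape nu) (hln : lam ⊆ nu) {M : ℕ} {S T U : L → Option ℤ}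
    (hS : Increasing S) (hSsh : shapeOf S = (lam : Set L))
    (hSin : TabIn (-(M : ℤ)) (2 * M + 1) S)
    (hU : IsURT U) (hUin : TabIn (-(M : ℤ)) (2 * M + 1) U) (hT : T ∈ rectFiber nu lam U) :
    TabIn (-(M : ℤ)) (2 * M + 1) T := by
  obtain ⟨M', hM'⟩ := exists_tabIn (finite_shapeOf_of_mem_rectFiber hT)
  have hS' := hSin.mono (le_max_left M M')
  have hT' := hM'.mono (le_max_right M M')
  have hval := (infuse_spec hl hnu hln hS hSsh hS' hT.1 hT.2.1 hT').2.2.2.2.2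
  rw [outerPart_infuse_of_mem_rectFiber hl hnu hln hS hSsh hS' hU hT hT'] at hval
  intro α x hx
  obtain ⟨β, hβ⟩ := hval α x hx
  exact hUin β x hβ

lemma innerPart_infuse_mem_rectFiber {lam mu nu : Finset L} (hl : StraightShape lam)
    (hnu : StraightShape nu) (hln : lam ⊆ nu) {M : ℕ}
    {S U : L → Option ℤ} (hS : IsURT S) (hSsh : shapeOf S = (lam : Set L))
    (hSin : TabIn (-(M : ℤ)) (2 * M + 1) S) (hU : IsURT U) (hUsh : shapeOf U = (mu : Set L))
    (hUin : TabIn (-(M : ℤ)) (2 * M + 1) U) {T : L → Option ℤ} (hT : T ∈ rectFiber nu lam U) :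
    mu ⊆ nu ∧ innerPart (infuse (-(M : ℤ)) (2 * M + 1) S T) ∈ rectFiber nu mu S ∧
      innerPart (infuse (-(M : ℤ)) (2 * M + 1) U
        (innerPart (infuse (-(M : ℤ)) (2 * M + 1) S T))) = T := by
  have hTin := tabIn_of_mem_rectFiber hl hnu hln hS.2.1 hSsh hSin hU hUin hT
  have hout := outerPart_infuse_of_mem_rectFiber hl hnu hln hS.2.1 hSsh hSin hU hT hTin
  obtain ⟨⟨mu', h1, h2, h3, h4⟩, h5, h6, -, h8, -⟩ :=
    infuse_spec hl hnu hln hS.2.1 hSsh hSin hT.1 hT.2.1 hTin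
  rw [hout] at h3 h8
  obtain rfl : mu' = mu := by
    rw [hUsh] at h3
    exact_mod_cast h3.symm
  have hslide := (infuse_spec h1 hnu h2 hU.2.1 hUsh hUin h5 h4 h6).2.2.2.1
  rw [h8, outerPart_flipTab, innerPart_combineTab] at hslide
  refine ⟨h2, ⟨h5, h4, hslide, hS.1⟩, ?_⟩
  rw [h8, innerPart_flipTab, outerPart_combineTab]
  intro α
  by_contra! hc
  have e1 : α ∈ shapeOf S := hc.1
  have e2 : α ∈ shapeOf T := hc.2
  rw [hSsh] at e1
  rw [hT.2.1] at e2
  exact e2.2 e1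

theorem ncard_rectFiber_comm {lam mu nu : Finset L} (hl : StraightShape lam)
    (hm : StraightShape mu) (hnu : StraightShape nu) (hln : lam ⊆ nu) (hmn : mu ⊆ nu)
    {S U : L → Option ℤ} (hS : IsURT S) (hSsh : shapeOf S = (lam : Set L))
    (hU : IsURT U) (hUsh : shapeOf U = (mu : Set L)) :
    (rectFiber nu lam U).ncard = (rectFiber nu mu S).ncard := by
  obtain ⟨M₁, h₁⟩ := exists_tabIn (T := S) (hSsh ▸ lam.finite_toSet)
  obtain ⟨M₂, h₂⟩ := exists_tabIn (T := U) (hUsh ▸ mu.finite_toSet)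
  have hSin := h₁.mono (le_max_left M₁ M₂)
  have hUin := h₂.mono (le_max_right M₁ M₂)
  have hf := fun T (hT : T ∈ rectFiber nu lam U) =>
    innerPart_infuse_mem_rectFiber hl hnu hln hS hSsh hSin hU hUsh hUin hT
  have hg := fun T (hT : T ∈ rectFiber nu mu S) =>
    innerPart_infuse_mem_rectFiber hm hnu hmn hU hUsh hUin hS hSsh hSin hT
  refine Set.ncard_congr (fun T _ => innerPart (infuse _ _ S T)) (fun T hT => (hf T hT).2.1) ?_ ?_
  · intro T T' hT hT' he
    rw [← (hf T hT).2.2, ← (hf T' hT').2.2]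
    exact congrArg (fun R => innerPart (infuse _ _ U R)) he
  · exact fun R hR => ⟨_, (hg R hR).2.1, (hg R hR).2.2⟩

lemma subset_of_mem_rectFiber {lam mu nu : Finset L} (hl : StraightShape lam)
    (hnu : StraightShape nu) (hln : lam ⊆ nu)
    {S U : L → Option ℤ} (hS : IsURT S) (hSsh : shapeOf S = (lam : Set L))
    (hU : IsURT U) (hUsh : shapeOf U = (mu : Set L)) {T : L → Option ℤ}
    (hT : T ∈ rectFiber nu lam U) : mu ⊆ nu := by
  obtain ⟨M₁, h₁⟩ := exists_tabIn (T := S) (hSsh ▸ lam.finite_toSet)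
  obtain ⟨M₂, h₂⟩ := exists_tabIn (T := U) (hUsh ▸ mu.finite_toSet)
  exact (innerPart_infuse_mem_rectFiber hl hnu hln hS hSsh (h₁.mono (le_max_left M₁ M₂)) hU hUsh
    (h₂.mono (le_max_right M₁ M₂)) hT).1

lemma shapeOf_minTab (lam : Finset L) : shapeOf (minTab lam) = (lam : Set L) := by
  ext α
  by_cases h : α ∈ lam <;> simp [shapeOf, minTab, h]

theorem ncard_rectFiber_eq_of_shapeOf_eq (hurp : IsURP L) {lam mu nu : Finset L}
    (hl : StraightShape lam) (hm : StraightShape mu) (hnu : StraightShape nu) (hln : lam ⊆ nu)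
    {U U' : L → Option ℤ} (hU : IsURT U) (hUsh : shapeOf U = (mu : Set L))
    (hU' : IsURT U') (hUsh' : shapeOf U' = (mu : Set L)) :
    (rectFiber nu lam U).ncard = (rectFiber nu lam U').ncard := by
  by_cases hmn : mu ⊆ nu
  · rw [ncard_rectFiber_comm hl hm hnu hln hmn (hurp lam hl) (shapeOf_minTab lam) hU hUsh,
      ncard_rectFiber_comm hl hm hnu hln hmn (hurp lam hl) (shapeOf_minTab lam) hU' hUsh']
  · have hempty : ∀ R : L → Option ℤ, IsURT R → shapeOf R = (mu : Set L) →
        rectFiber nu lam R = ∅ := fun R hR hRsh =>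
      Set.eq_empty_of_forall_notMem fun T hT =>
        hmn (subset_of_mem_rectFiber hl hnu hln (hurp lam hl) (shapeOf_minTab lam) hR hRsh hT)
    rw [hempty U hU hUsh, hempty U' hU' hUsh']

end Infusion

theorem lr_rule_with_urt {L : Type} [PartialOrder L]
    (hmin : {x : L | ∀ y : L, ¬ y < x}.Finite)
    (hcov : ∀ x : L, {y : L | x ⋖ y}.Finite)
    (hurp : IsURP L)
    (lam mu nu : Finset L)
    (hl : StraightShape lam) (hm : StraightShape mu) (hn : StraightShape nu)
    (U : L → Option ℤ) (hU : IsURT U) (hUsh : shapeOf U = (mu : Set L)) :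
    ccoef lam mu nu = Set.ncard {T : L → Option ℤ | Increasing T ∧
      shapeOf T = (nu : Set L) \ (lam : Set L) ∧ RectifiesTo T U} := by
  have hl' : StraightShape (nu ∩ lam) := by
    intro α hα β hle
    rw [Finset.mem_inter] at hα ⊢
    exact ⟨hn α hα.1 β hle, hl α hα.2 β hle⟩
  have h := ncard_rectFiber_eq_of_shapeOf_eq hurp hl' hm hn Finset.inter_subset_left
    (hurp mu hm) (shapeOf_minTab mu) hU hUsh
  have hset : (nu : Set L) \ ((nu ∩ lam : Finset L) : Set L) = (nu : Set L) \ (lam : Set L) := by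
    rw [Finset.coe_inter, Set.sdiff_self_inter]
  simpa only [ccoef, rectFiber, hset] using h
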